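/- arXiv:0901.4604 — 2 statements merged into one kernel-verified Lean document; each statement's English description precedes it below -/
import Mathlib

section
/- Exterior solution of the Laplace-transformed Black–Scholes equation (Proposition 3.7): let σ > 0 and r be real constants, z ∈ ℂ, and set λ = (−(r − σ²/2) − √((r − σ²/2)² + 2σ²(r + z))) / σ², where √ is the principal complex square root. Then the function û₊(x) = x^λ (complex power of the positive real x) satisfies, for every x ∈ ℝ₊: (i) z û₊(x) − (σ² x²/2) û₊''(x) − r x û₊'(x) + r û₊(x) = 0, and (ii) the transparent boundary relation û₊'(x) = (1/(x σ²)) (−(r − σ²/2) − √((r − σ²/2)² + 2σ²(r + z))) û₊(x). -/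
open Complex Set

/-- Exterior solution of the Laplace-transformed Black–Scholes equation:
with `λ = (−(r − σ²/2) − √((r − σ²/2)² + 2σ²(r + z)))/σ²`, the function
`û₊(x) = x^λ = exp(λ log x)` satisfies, for every `x ∈ ℝ₊`, the transformed
Black–Scholes ODE and the transparent boundary relation. -/
theorem exterior_solution_transparent_bc
    (σ r : ℝ) (hσ : 0 < σ) (z : ℂ) (lam : ℂ)
    (hlam : lam = (-(((r : ℂ) - σ ^ 2 / 2))
        - ((((r : ℂ) - σ ^ 2 / 2) ^ 2 + 2 * σ ^ 2 * ((r : ℂ) + z)) ^ ((1:ℂ)/2)))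
      / (σ ^ 2 : ℂ))
    (u : ℝ → ℂ) (hu : u = fun x : ℝ => Complex.exp (lam * Real.log x)) :
    ∀ x ∈ Set.Ioi (0:ℝ),
      z * u x - ((σ ^ 2 : ℂ) * (x : ℂ) ^ 2 / 2) * deriv (deriv u) x
          - (r : ℂ) * (x : ℂ) * deriv u x + (r : ℂ) * u x = 0 ∧
      deriv u x = (1 / ((x : ℂ) * σ ^ 2))
          * (-(((r : ℂ) - σ ^ 2 / 2))
            - ((((r : ℂ) - σ ^ 2 / 2) ^ 2 + 2 * σ ^ 2 * ((r : ℂ) + z)) ^ ((1:ℂ)/2)))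
          * u x := by
  have hσ' : (σ : ℂ) ≠ 0 := by exact_mod_cast hσ.ne'
  have hS : (((((r : ℂ) - σ ^ 2 / 2) ^ 2 + 2 * σ ^ 2 * ((r : ℂ) + z)) ^ ((1:ℂ)/2))) ^ 2
      = (((r : ℂ) - σ ^ 2 / 2) ^ 2 + 2 * σ ^ 2 * ((r : ℂ) + z)) := by
    have h := Complex.cpow_nat_inv_pow
      (((r : ℂ) - σ ^ 2 / 2) ^ 2 + 2 * σ ^ 2 * ((r : ℂ) + z)) (n := 2) (by norm_num)
    rw [one_div]
    exact_mod_cast h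
  generalize ((((r : ℂ) - σ ^ 2 / 2) ^ 2 + 2 * σ ^ 2 * ((r : ℂ) + z)) ^ ((1:ℂ)/2)) = S at *
  have hL : (σ : ℂ) ^ 2 * lam = -(((r : ℂ) - σ ^ 2 / 2)) - S := by
    rw [hlam]; field_simp
  have hquad : (σ : ℂ) ^ 2 / 2 * lam ^ 2 + ((r : ℂ) - σ ^ 2 / 2) * lam - (r + z) = 0 := by
    have h2 : (σ : ℂ) ^ 2 * ((σ : ℂ) ^ 2 / 2 * lam ^ 2
        + ((r : ℂ) - σ ^ 2 / 2) * lam - (r + z)) = 0 := by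
      have hS' : S = -(((r : ℂ) - σ ^ 2 / 2)) - (σ : ℂ) ^ 2 * lam := by rw [hL]; ring
      rw [hS'] at hS
      linear_combination hS / 2
    exact (mul_eq_zero.mp h2).resolve_left (pow_ne_zero 2 hσ')
  have hd : ∀ x : ℝ, 0 < x → HasDerivAt u (lam * (x : ℂ)⁻¹ * u x) x := by
    intro x hx
    have h1 := (((Real.hasDerivAt_log hx.ne').ofReal_comp).const_mul lam).cexp
    rw [hu]
    convert h1 using 1
    push_cast
    ring
  intro x hx
  have hx : 0 < x := hx
  have hx' : (x : ℂ) ≠ 0 := by exact_mod_cast hx.ne'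
  have hev : deriv u =ᶠ[nhds x] fun y : ℝ => lam * (y : ℂ)⁻¹ * u y := by
    filter_upwards [Ioi_mem_nhds hx] with y hy
    exact (hd y hy).deriv
  have hinv : HasDerivAt (fun y : ℝ => ((y : ℂ))⁻¹) (-((x : ℂ) ^ 2)⁻¹) x := by
    have h := (hasDerivAt_inv hx.ne').ofReal_comp
    simpa using h
  have hdd : deriv (deriv u) x = lam * (-((x : ℂ) ^ 2)⁻¹) * u x
      + lam * (x : ℂ)⁻¹ * (lam * (x : ℂ)⁻¹ * u x) := by
    rw [hev.deriv_eq]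
    exact ((hinv.const_mul lam).mul (hd x hx)).deriv
  rw [hdd, (hd x hx).deriv]
  constructor
  · have e : (x : ℂ) * (x : ℂ)⁻¹ = 1 := mul_inv_cancel₀ hx'
    field_simp
    linear_combination (-2 * u x) * hquad
  · rw [← hL]
    field_simp
end

section
/- Decay at infinity of the exterior solution: let σ > 0 and r be real constants and let z ∈ ℂ with Re z > −r. Set w = (r − σ²/2)² + 2σ²(r + z) and λ = (−(r − σ²/2) − √w) / σ² with √ the principal complex square root. Then Re w > (r − σ²/2)², hence w does not lie on the nonpositive real axis, Re(√w) > |r − σ²/2|, and consequently Re λ < 0; therefore x^λ → 0 as x → ∞. -/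
open Complex Filter

/-- Decay at infinity of the exterior solution: for `Re z > −r`, with
`w = (r − σ²/2)² + 2σ²(r + z)` and `λ = (−(r − σ²/2) − √w)/σ²`, one has
`Re w > (r − σ²/2)²`, `w` is off the nonpositive real axis,
`Re √w > |r − σ²/2|`, `Re λ < 0`, and `x^λ = exp(λ log x) → 0` as `x → ∞`. -/
theorem exterior_solution_decay
    (σ r : ℝ) (hσ : 0 < σ) (z : ℂ) (hz : -r < z.re)
    (w lam : ℂ)
    (hw : w = ((r : ℂ) - σ ^ 2 / 2) ^ 2 + 2 * σ ^ 2 * ((r : ℂ) + z))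
    (hlam : lam = (-(((r : ℂ) - σ ^ 2 / 2)) - w ^ ((1:ℂ)/2)) / (σ ^ 2 : ℂ)) :
    (r - σ ^ 2 / 2) ^ 2 < w.re ∧
    ¬ (w.re ≤ 0 ∧ w.im = 0) ∧
    |r - σ ^ 2 / 2| < (w ^ ((1:ℂ)/2)).re ∧
    lam.re < 0 ∧
    Tendsto (fun x : ℝ => Complex.exp (lam * Real.log x)) atTop (nhds 0) := by
  have h1 : (r - σ ^ 2 / 2) ^ 2 < w.re := by
    have e : w = (((r - σ ^ 2 / 2) ^ 2 + 2 * σ ^ 2 * r : ℝ) : ℂ) + ((2 * σ ^ 2 : ℝ) : ℂ) * z := by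
      rw [hw]; push_cast; ring
    have e2 : w.re = (r - σ ^ 2 / 2) ^ 2 + 2 * σ ^ 2 * r + 2 * σ ^ 2 * z.re := by
      rw [e, Complex.add_re, Complex.re_ofReal_mul, Complex.ofReal_re]
    have h : 0 < σ ^ 2 * (r + z.re) := mul_pos (pow_pos hσ 2) (by linarith)
    rw [e2]; linarith
  have h3 : |r - σ ^ 2 / 2| < (w ^ ((1:ℂ)/2)).re := by
    rw [one_div, Complex.cpow_inv_two_re, ← Real.sqrt_sq_eq_abs]
    apply Real.sqrt_lt_sqrt (sq_nonneg _)
    have := Complex.re_le_norm w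
    linarith
  have h4 : lam.re < 0 := by
    have e : lam = ((-(((r - σ ^ 2 / 2 : ℝ) : ℂ))) - w ^ ((1:ℂ)/2)) / ((σ ^ 2 : ℝ) : ℂ) := by
      rw [hlam]; push_cast; ring
    rw [e, Complex.div_ofReal_re, Complex.sub_re, Complex.neg_re, Complex.ofReal_re]
    apply div_neg_of_neg_of_pos _ (pow_pos hσ 2)
    have := neg_abs_le (r - σ ^ 2 / 2)
    linarith
  refine ⟨h1, ?_, h3, h4, ?_⟩
  · rintro ⟨h, -⟩
    have := sq_nonneg (r - σ ^ 2 / 2)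
    linarith
  · rw [Complex.tendsto_exp_nhds_zero_iff]
    have e : (fun x : ℝ => (lam * (Real.log x : ℂ)).re) = fun x : ℝ => lam.re * Real.log x := by
      funext x; rw [Complex.re_mul_ofReal]
    rw [e]
    exact Real.tendsto_log_atTop.const_mul_atTop_of_neg h4
end
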